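/- Up to isomorphism, there are precisely six strongly (4,4)-clique-partitioned graphs with exactly 4·4·3/2 + 4·4·3·2/2 = 72 edges (the maximum possible); that is, there exist exactly six isomorphism classes of maximal strongly (4,4)-clique-partitioned graphs. -/

import Mathlib

open SimpleGraph Finset

/-- A decomposition of the vertex set of `G` into `n` pairwise disjoint `v`-cliques. -/
def IsCliquePartition {V : Type} [Fintype V] [DecidableEq V] (G : SimpleGraph V)
    (n v : ℕ) (P : Finset (Finset V)) : Prop :=
  P.card = n ∧ (∀ s ∈ P, G.IsNClique v s) ∧
    (∀ s ∈ P, ∀ t ∈ P, s ≠ t → Disjoint s t) ∧ P.biUnion id = Finset.univ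

/-- `G` is weakly `(n,v)`-clique-partitioned: it has `n*v` vertices and its vertex set
can be decomposed in exactly one way into `n` pairwise disjoint `v`-cliques. -/
def WeaklyCP {V : Type} [Fintype V] [DecidableEq V] (G : SimpleGraph V) (n v : ℕ) : Prop :=
  Fintype.card V = n * v ∧ ∃! P : Finset (Finset V), IsCliquePartition G n v P

/-- `G` is strongly `(n,v)`-clique-partitioned: weakly so, and moreover the only
`v`-cliques of `G` are the `n` cliques of the (unique) decomposition. -/
def StronglyCP {V : Type} [Fintype V] [DecidableEq V] (G : SimpleGraph V) (n v : ℕ) : Prop :=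
  WeaklyCP G n v ∧
    ∀ P : Finset (Finset V), IsCliquePartition G n v P →
      ∀ s : Finset V, G.IsNClique v s → s ∈ P

/-- Entry `(i, j)` of the `4 × 4` Boolean matrix packed into the bits of `m`. -/
def bit (m i j : ℕ) : Bool := m.testBit (4 * i + j)

/-- Masks of the two-element subsets of `{0, 1, 2, 3}`. -/
def pairMasks : List ℕ := [3, 5, 6, 9, 10, 12]

/-- The packed biadjacency matrices of all 8-cycles in `K₄,₄`. -/
def octagons : List ℕ :=
  [51795, 44115, 51555, 40035, 50835, 27795, 50595, 23715, 42435, 38595, 27075, 23235, 51765,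
   44085, 43365, 39525, 42645, 27285, 50085, 38565, 27045, 15525, 41925, 15045, 51510, 39990,
   43350, 39510, 50070, 42390, 23190, 15510, 38310, 22950, 37830, 14790, 50745, 27705, 42585,
   27225, 50025, 42345, 23145, 15465, 26025, 22185, 25545, 14025, 50490, 23610, 50010, 38490,
   26970, 15450, 38250, 22890, 26010, 22170, 21450, 13770, 42300, 38460, 26940, 23100, 41820,
   14940, 37740, 14700, 25500, 13980, 21420, 13740]

/-- The biadjacency matrix every 8-cycle in `K₄,₄` can be relabelled to. -/
def stdOctagon : ℕ := 50745

/-- The 8-cycles in `K₄,₄` up to relabelling the second side. -/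
def halfStdOctagons : List ℕ := [50745, 50835, 50025]

theorem exists_pairMask : ∀ a b : Fin 4, a ≠ b →
    ∃ r ∈ pairMasks, ∀ k : Fin 4, r.testBit k = true ↔ (k = a ∨ k = b) := by decide

theorem octagon_of_rows : ∀ r₀ ∈ pairMasks, ∀ r₁ ∈ pairMasks, ∀ r₂ ∈ pairMasks, ∀ r₃ ∈ pairMasks,
    r₀ ≠ r₁ → r₀ ≠ r₂ → r₀ ≠ r₃ → r₁ ≠ r₂ → r₁ ≠ r₃ → r₂ ≠ r₃ →
    (∀ j : Fin 4, ∃ s ∈ pairMasks, r₀.testBit j = s.testBit 0 ∧ r₁.testBit j = s.testBit 1 ∧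
      r₂.testBit j = s.testBit 2 ∧ r₃.testBit j = s.testBit 3) →
    ∃ m ∈ octagons, ∀ j : Fin 4, bit m 0 j = r₀.testBit j ∧ bit m 1 j = r₁.testBit j ∧
      bit m 2 j = r₂.testBit j ∧ bit m 3 j = r₃.testBit j := by
  decide +kernel

theorem exists_perm_halfStd : ∀ m ∈ octagons, ∃ t ∈ halfStdOctagons, ∃ τ : Equiv.Perm (Fin 4),
    ∀ i j : Fin 4, bit m i (τ j) = bit t i j := by decide +kernel

theorem exists_perm_std : ∀ m ∈ halfStdOctagons, ∃ σ τ : Equiv.Perm (Fin 4),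
    ∀ i j : Fin 4, bit m (σ i) (τ j) = bit stdOctagon i j := by decide +kernel

/-- The packed biadjacency matrices between the six pairs of parts of a graph on four parts. -/
structure Blocks where
  m01 : ℕ
  m02 : ℕ
  m03 : ℕ
  m12 : ℕ
  m13 : ℕ
  m23 : ℕ

/-- For three parts with biadjacency matrices `ab`, `ac`, `bc`, adjacent vertices in two different
parts have different neighbourhoods in the third. -/
def twinFree (ab ac bc : ℕ) : Bool :=
  let R := List.range 4
  R.all fun i => R.all fun j =>
    (!bit bc i j || R.any fun k => bit ab k i != bit ac k j) &&
    (!bit ac i j || R.any fun k => bit ab i k != bit bc k j) &&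
    (!bit ab i j || R.any fun k => bit ac i k != bit bc j k)

/-- No `K₄` has one vertex in each part. -/
def rainbowFree (c : Blocks) : Bool :=
  let R := List.range 4
  R.all fun i => R.all fun j => !bit c.m01 i j || R.all fun k =>
    !(bit c.m02 i k && bit c.m12 j k) || R.all fun l =>
      !(bit c.m03 i l && bit c.m13 j l && bit c.m23 k l)

/-- The `16 × 16` adjacency matrices of representatives of the six isomorphism classes, packed into
bits. -/
def repCode : Fin 6 → ℕ :=
  ![53559716125920274034657361708685696814191985932815008729417120224732933626270,
    53559674715863445671040310661962736300839855294731118931332233385118292351390,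
    52202784481916824873977223276950640335523488627216163233169401043628087679390,
    53559672127734893898363285202977551896578954155921487770674562654048188471710,
    53559672127734893898363285062674821971391357233445781966340815697169992227230,
    53559716072783628930985794348412285309342970063650070113130106215916824795550]

/-- Hexadecimal digit `u` of `w`, the value at `u` of the map on `{0, …, 15}` packed into `w`. -/
def digit (w u : ℕ) : ℕ := w / 16 ^ u % 16

/-- For each normalised graph whose blocks between part `0` and parts `2`, `3` are `t₂`, `t₃`, its
remaining blocks packed into one number, paired with a permutation of `{0, …, 15}` carrying it to a
representative, whose index is the leading hexadecimal digit. Here `4 * p + i` is vertex `i` of part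
`p`. -/
def renamings (t₂ t₃ : ℕ) : List (ℕ × ℕ) :=
  match t₂, t₃ with
  | 50745, 50745 =>
    [(63523535600070, 92151734839331271184), (63523535600220, 66488988158641578753),
     (63523535606730, 61570006524494619393), (63523535608470, 60341349503334289968),
     (63523535610780, 87232753205184311824), (63523535612250, 65260331137481249328),
     (63523545430620, 25744807271045210371), (63523545441180, 65404035681476739873),
     (63523972076490, 24676518377075516161), (63523972080540, 60484978989626622753),
     (63524086110870, 23447861355915186736), (63524086113180, 68786009131474760208),
     (63524237501340, 82313696513334194704), (63524333839260, 63866952439624643088),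
     (63524333840730, 26973464292205539856), (64167780694470, 70323017315623699233),
     (64167780701130, 35582770539339129091), (64167790524870, 29595650126628791041),
     (64167790525020, 16067887687066198785), (64167790531530, 11148906052919239425),
     (64167790533270, 48042394200338342657), (64167790535580, 34514631760775750401),
     (64167790537050, 52961375834485302017), (64168217170890, 6229849361069122305),
     (64168331203530, 49110457921198563587), (64168331205270, 41894605429624738352),
     (64168482591690, 30663713847489011971), (64168482595740, 71408119908194853633),
     (64168578929610, 54029514613048680707), (64168578935130, 45420133308211933712),
     (92128017791430, 70322942257920541473), (92128017791580, 29595500011222475521),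
     (92128027621980, 16067812629363041025), (92128454261190, 35582845597042286851),
     (92128454261340, 11148755937512923905), (92128454267850, 6229774303365964545),
     (92128454269590, 49110608036604879107), (92128454271900, 30663863962895327491),
     (92128454273370, 54029589670751838467), (92128568293980, 48042244084932027137),
     (92128568302230, 41894680487327896112), (92128719682140, 34514556703072592641),
     (92128719692700, 71408044850491695873), (92128816020060, 52961300776782144257),
     (92128816032090, 45420208365915091472), (99601260886470, 73704990765621719568),
     (99601260898650, 28366842990062146096), (99601270717020, 44191476287051604227),
     (99601270729050, 46813587063771697712), (99601697362890, 43123262450785067777),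
     (99601697368410, 51732643755621814832), (99601811388870, 36811502618202616336),
     (99601811389020, 50339265057765208592), (99601811395530, 55258246691912167952),
     (99601811397270, 18364758544493064720), (99601811399580, 31892520984055656976),
     (99601811401050, 13445776910346105360), (99601962787740, 70179387829331366448),
     (99601962789210, 33285899681912263216), (99602059127130, 8526720218495988240),
     (109522635340230, 92151659781628113424), (109522645170630, 66489138274047894273),
     (109522645170780, 25744732213342052611), (109523071809990, 61570081582197777153),
     (109523071816650, 24676593434778673921), (109523185842630, 60341424561037447728),
     (109523185851030, 23447936413618344496), (109523337230790, 87232603089777996304),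
     (109523337230940, 65403885566070424353), (109523337237450, 60484903931923464993),
     (109523337239190, 68785859016068444688), (109523337241500, 82313621455631036944),
     (109523337242970, 63866877381921485328), (109523433568710, 65260481252887564848),
     (109523433580890, 26973389234502382096), (115836237265350, 73704915707918561808),
     (115836237273750, 36811427560499458576), (115836247095900, 44191551344754761987),
     (115836247104150, 50339114942358893072), (115836673741770, 43123337508488225537),
     (115836673743510, 55258171634209010192), (115836787776150, 18364683486789906960),
     (115836939164310, 31892370868649341456), (115836939166620, 70179462887034524208),
     (115837035493830, 28366993105468461616), (115837035493980, 46813737179178013232),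
     (115837035500490, 51732718813324972592), (115837035502230, 13445626794939789840),
     (115837035504540, 33285974739615420976), (115837035506010, 8526645160792830480)]
  | 50745, 50835 =>
    [(63524070381990, 65328035246940255318), (63524070385980, 25685699713830001336),
     (63524331874620, 3607554322286404980), (63525045557670, 26905647884742396841),
     (63525045561660, 3607629379332843960), (63525045572550, 1167240236674795350),
     (63525045576540, 26833909002546293131), (63525307050300, 25757438596026120346),
     (63525307065180, 65399848602866570868), (64168315476390, 107072911024218382595),
     (64168576969020, 40501042469705508212), (64169290666950, 19613909252681189206),
     (64169552159580, 107216505463042802465), (92128552573350, 107072986081921540355),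
     (92128814065980, 40501117527408665972), (92129527763910, 19613984310384346966),
     (92129789256540, 107216430405339644705), (99601795668390, 109513376320469676050),
     (99602057161020, 22054373453699114356), (99602770858950, 38060728384093898582),
     (99603032351580, 109369711786709422640), (109523170122150, 65327861677075428438),
     (109523170137030, 26905891547403946921), (109523431610790, 25685456051168451256),
     (109523431614780, 3607629379989562740), (109523431625670, 3607511282419149240),
     (109523431629660, 25757265026161293466), (109524145312710, 1167165178971637590),
     (109524406801350, 26834082572411120011), (109524406805340, 65399604940205020788),
     (115836772047270, 109513301262766518290), (115837033539900, 22054298395995956596),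
     (115837747237830, 38060653326390740822), (115838008730460, 109369786844412580400)]
  | 50745, 50025 =>
    [(63523468752330, 68646435096215966838), (63523468752540, 23587318129399802761),
     (63523482515100, 2378948068414150470), (63524340708810, 24663685328294296216),
     (63524340709020, 225556323263953320), (63524340722115, 225722030546842980),
     (63524340722325, 23515300280382822586), (63524354471580, 24735703177311259051),
     (63524354484885, 67497984334168487508), (64167713846730, 110454849426748473635),
     (64167727609500, 20825692142123702086), (64168585816515, 37119135120262788452),
     (64168599579285, 108158055817491522305), (92127950943690, 110454924484451631395),
     (92127964706460, 20825767199826859846), (92128822913475, 37119210177965946212),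
     (92128836676245, 108157980759788364545), (99601194038730, 108301530807444049970),
     (99601207801500, 39272436215833253702), (99602066008515, 18672391046553236836),
     (99602079771285, 110598478913040822800), (109522568492490, 68646679016571622518),
     (109522568505795, 24663924867850156696), (109522582255050, 23587078589843942281),
     (109522582255260, 2379023126117308230), (109522582268355, 225722029163657640),
     (109522582268565, 24735459256955603371), (109523440462275, 225646972843685220),
     (109523454224835, 23515544200738478266), (109523454225045, 67498223873724347988),
     (115836170417610, 108301605865147207730), (115836184180380, 39272511273536411462),
     (115837042387395, 18672466104256394596), (115837056150165, 110598403855337665040)]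
  | 50835, 50745 =>
    [(98570468743590, 35726321872979139256), (98570468747580, 70179463917468808278),
     (98570478577980, 99531748518950281475), (98570905217340, 104450805210800398595),
     (98571019249980, 104594394686322716690), (98571170638140, 58804215686309573718),
     (98571170653020, 35582788253506505641), (98571266976060, 99675337994472599570),
     (115707388254630, 11207825670720611700), (115707398085030, 48101313818139714932),
     (115707824724390, 53020370509989832052), (115707938757030, 34573626436280280436),
     (115708090145190, 16126882362570728820), (115708090149180, 19757402022971546296),
     (115708090160070, 21910686689456535706), (115708090164060, 8387164929103145400),
     (115708186483110, 29654569744430163316), (162479582108070, 16126882361914010040),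
     (162479582112060, 19613868403498912681), (162479582122950, 22054255355862296971),
     (162479582126940, 16055069006126335830), (162479591957340, 29582756387985770326),
     (162480018596700, 34501813079835887446), (162480132629340, 52948557153545439062),
     (162480284017500, 11136012314276218710), (162480380355420, 48029500461695321942),
     (179616501619110, 33285934920615770266), (179616501633990, 72619853060265498228),
     (179616511464390, 102297523828895843105), (179616938103750, 97378467137045725985),
     (179617052136390, 97234947755389686320), (179617203524550, 56650933210257905268),
     (179617203528540, 33429503587021531531), (179617299862470, 102154004447239803440)]
  | 50835, 50835 =>
    [(98571003509190, 9987804056603751510), (98571003509340, 51800273838169814102),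
     (98571003515850, 46881292204022854742), (98571003517590, 28434548130313303126),
     (98571003519900, 14906785690750710870), (98571003521370, 33353529764460262486),
     (98571265008540, 19757555230707128971), (98571978695580, 21910801565193910441),
     (98572240184220, 14978519864659974840), (115707923020230, 35726231418053171851),
     (115708184508870, 58947844142076159348), (115708184509020, 99531708507645485360),
     (115708184515530, 104450690141792444720), (115708184517270, 104594244570916401185),
     (115708184519580, 70322918803370567028), (115708184521050, 99675262936769441825),
     (115709159695260, 35582676989781511066), (162480116873670, 33285876226488318121),
     (162481092049350, 56507488950477866838), (162481092049500, 102297373713489527570),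
     (162481092056010, 97378392079342568210), (162481092057750, 97234837651288166915),
     (162481092060060, 72476165137823909718), (162481092061530, 102153819285435126275),
     (162481353548700, 33429430655294745016), (179617036384710, 7238920528762804920),
     (179617297873350, 19614000802435468186), (179618011560390, 22054355994000337336),
     (179618273049030, 14978562904527230580), (179618273049180, 33425306978236782196),
     (179618273055690, 28506325344089822836), (179618273057430, 46953069417799374452),
     (179618273059740, 10059581270380271220), (179618273061210, 51872051051946333812)]
  | 50835, 50025 =>
    [(98570401888620, 43110686400601766552), (98570401912170, 55253929857257609912),
     (98570415651180, 39416011905725540537), (98571273845100, 39272513333202754442),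
     (98571287607660, 43182448281812961707), (98571287608005, 55182172356846193577),
     (115707321423210, 53028777521284680602), (115707335162220, 40500949887091648667),
     (115707335162565, 44203959686791150217), (115707335185770, 45352375401120041402),
     (115707335186115, 38204112982734904232), (115708207119045, 54177197616413383307),
     (162479515276650, 53961902115746265257), (162480387209580, 40357414077235837322),
     (162480387209925, 45280636519375154072), (162480387233130, 44132216424279873707),
     (162480387233475, 38060579363278981817), (162480400972485, 52813486401450781112),
     (179616434787690, 51736917547259308427), (179616434788035, 42034027091751709577),
     (179616448550595, 37119177191233927592), (179617306744515, 36975676428311235227),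
     (179617320483525, 51808677238037199002), (179617320507075, 41962271781773613242)]
  | 50025, 50745 =>
    [(59142668957130, 36667823651377228681), (59142668957340, 57719180289575244918),
     (59142678787740, 100616886158454554915), (59143105427100, 105535942850304672035),
     (59143219459740, 98320017491461017650), (59143370847900, 73704988638181545078),
     (59143370861205, 34371004269133413016), (59143467185820, 103239074183311134770),
     (60044612089290, 13306202875054872390), (60044621919690, 31752946948764424006),
     (60045048559050, 36672003640614541126), (60045162591690, 50199691022473975622),
     (60045313979850, 18225259566904989510), (60045313980060, 20969119778948950921),
     (60045313993155, 18528749253832772011), (60045313993365, 17076808803775134120),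
     (60045410317770, 55118747714324092742), (116287208830410, 6216941254853114280),
     (116287208830620, 18672300396705135256), (116287208843715, 20825566445643274426),
     (116287208843925, 17076808805158319460), (116287218674325, 49051240260727305572),
     (116287645313685, 53970296952577422692), (116287759346325, 30604496187017753956),
     (116287910734485, 12157752113308202340), (116288007072405, 35523552878867871076),
     (117189151962570, 34514557602439072171), (117189151975875, 55565879193703970388),
     (117189161806275, 103382624231033676545), (117189588445635, 98463567539183559425),
     (117189702478275, 105679497278893863440), (117189853866435, 71264583066132248148),
     (117189853866645, 36811374794249574586), (117189950204355, 100760440587043746320)]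
  | 50025, 50835 =>
    [(59143203738540, 53961944123171781272), (59143203755580, 44132460280213969592),
     (59143465244220, 38060729607536282522), (59144178931260, 40357579655044446377),
     (59144440419900, 45280824520111860107), (59144440424025, 52813509790477167497),
     (60045146870700, 51736828057677637817), (60045408359340, 42033839219865987227),
     (60045408363465, 37119061156629035657), (60045408376380, 36975526441755904442),
     (60045408380505, 41962028054690503592), (60046383556185, 51808569130056399272),
     (116287743611820, 55253855701227248522), (116288718787500, 43110478815367641482),
     (116288718791625, 39415913394570505112), (116288718804540, 39272343633299019947),
     (116288718808665, 43182219888281160377), (116288980297305, 55182044535516990107),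
     (117189686743980, 53028855670559181227), (117189686748105, 45352653209004575657),
     (117189948236745, 38204299368841190027), (117190661923785, 40501114369950984632),
     (117190923412425, 44204183829376841882), (117190923429465, 54177254957390207162)]
  | 50025, 50025 =>
    [(59142602111430, 13306444669434156150), (59142602111580, 31753188743143707766),
     (59142602118090, 36672170377290667126), (59142602119830, 50199932816853259382),
     (59142602122140, 18225426303581115510), (59142602123610, 55118914451000218742),
     (59142615884700, 20969319371623540921), (59143474078620, 18528898467309718171),
     (59143487841180, 17076900225053997720), (60044545243590, 36667783704495958201),
     (60044559006150, 57719257473254774598), (60044559006300, 100616811100751397395),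
     (60044559012810, 105535792734898356755), (60044559014550, 98319940243357963010),
     (60044559016860, 73704821901505419078), (60044559018330, 103238921877504922370),
     (60045430973340, 34370912847854549416), (116287141984710, 34514462895560362651),
     (116288013941190, 55565936663784420708), (116288013941340, 103382476306027257905),
     (116288013947850, 98463494671880298545), (116288013949590, 105679347163487547680),
     (116288013951900, 71264400996656837988), (116288013953370, 100760365529340588320),
     (116288027714460, 36811333752168356746), (117189085116870, 6217198382031682200),
     (117189098879430, 18672448514982132136), (117189957073350, 20825769323917712266),
     (117189970835910, 17076990874633729620), (117189970836060, 49051497387905873492),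
     (117189970842570, 53970479022052832852), (117189970844310, 30604753314196321876),
     (117189970846620, 12158009240486770260), (117189970848090, 35523734948343281236)]
  | _, _ => []

/-- The map packed into `w` is injective and carries the graph of `c` to that of the packed
adjacency matrix `r`. -/
def carries (w : ℕ) (c : Blocks) (r : ℕ) : Bool :=
  let R := List.range 4
  let image (p q i j : ℕ) : Bool := r.testBit (16 * digit w (4 * p + i) + digit w (4 * q + j))
  let block (p q m : ℕ) : Bool := R.all fun i => R.all fun j => bit m i j == image p q i j
  block 0 1 c.m01 && block 0 2 c.m02 && block 0 3 c.m03 && block 1 2 c.m12 && block 1 3 c.m13 &&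
    block 2 3 c.m23 && (R.all fun p => R.all fun i => R.all fun j => i == j || image p p i j) &&
    decide ((List.range 16).map (digit w)).Nodup

/-- Every admissible completion of given blocks between part `0` and the other parts is carried to
a representative by one of the listed renamings. -/
def allCarried (t₂ t₃ : ℕ) : Bool :=
  (octagons.filter (twinFree stdOctagon t₂)).all fun x =>
    (octagons.filter (twinFree stdOctagon t₃)).all fun y =>
      (octagons.filter (twinFree t₂ t₃)).all fun z =>
        !twinFree x y z || !rainbowFree ⟨stdOctagon, t₂, t₃, x, y, z⟩ ||
          (renamings t₂ t₃).any fun e => e.1 == x * 2 ^ 32 + y * 2 ^ 16 + z &&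
            (List.finRange 6).any fun i => i.val == digit e.2 16 &&
              carries e.2 ⟨stdOctagon, t₂, t₃, x, y, z⟩ (repCode i)

theorem allCarried_halfStdOctagons :
    ∀ t₂ ∈ halfStdOctagons, ∀ t₃ ∈ halfStdOctagons, allCarried t₂ t₃ = true := by
  decide +kernel

/-- The representatives of the six isomorphism classes, with parts `{4 * p, …, 4 * p + 3}`. -/
def repGraph (k : Fin 6) : SimpleGraph (Fin 16) where
  Adj u v := (repCode k).testBit (16 * u + v) = true
  symm := ⟨by revert k; decide +kernel⟩
  loopless := ⟨by revert k; decide +kernel⟩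

instance (k : Fin 6) : DecidableRel (repGraph k).Adj :=
  fun _ _ => inferInstanceAs (Decidable (_ = true))

theorem repGraph_part (k : Fin 6) :
    ∀ u v : Fin 16, u.val / 4 = v.val / 4 → u ≠ v → (repGraph k).Adj u v := by
  revert k; decide +kernel

theorem repGraph_clique (k : Fin 6) : ∀ x y : Fin 16, (repGraph k).Adj x y →
    ∀ z, (repGraph k).Adj x z → (repGraph k).Adj y z →
    ∀ w, (repGraph k).Adj x w → (repGraph k).Adj y w → (repGraph k).Adj z w →
    x.val / 4 = y.val / 4 := by
  revert k; decide +kernel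

theorem repGraph_degree (k : Fin 6) : ∀ v, (repGraph k).degree v = 9 := by
  revert k; decide +kernel

theorem card_edgeSet_repGraph (k : Fin 6) : Nat.card (repGraph k).edgeSet = 72 := by
  have h := (repGraph k).sum_degrees_eq_twice_card_edges
  simp only [repGraph_degree, sum_const, card_univ, Fintype.card_fin, smul_eq_mul] at h
  rw [Nat.card_eq_fintype_card, ← edgeFinset_card]
  omega

/-- A graph in which every `v`-clique belongs to a given partition into `v`-cliques is strongly
clique-partitioned. -/
theorem stronglyCP_of_partition {V : Type} [Fintype V] [DecidableEq V] {G : SimpleGraph V}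
    {n v : ℕ} {P : Finset (Finset V)} (hP : IsCliquePartition G n v P)
    (hG : ∀ s, G.IsNClique v s → s ∈ P) : StronglyCP G n v := by
  have huniq : ∀ Q, IsCliquePartition G n v Q → Q = P := fun Q hQ =>
    eq_of_subset_of_card_le (fun s hs => hG s (hQ.2.1 s hs)) (by rw [hP.1, hQ.1])
  refine ⟨⟨?_, P, hP, huniq⟩, fun Q hQ s hs => huniq Q hQ ▸ hG s hs⟩
  calc Fintype.card V = #(P.biUnion id) := by rw [hP.2.2.2, card_univ]
    _ = ∑ s ∈ P, #s := card_biUnion hP.2.2.1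
    _ = n * v := by rw [sum_congr rfl fun s hs => (hP.2.1 s hs).2, sum_const, hP.1, smul_eq_mul]

theorem is4Clique_iff {V : Type*} [DecidableEq V] {G : SimpleGraph V} {s : Finset V} :
    G.IsNClique 4 s ↔ ∃ a b c d, G.Adj a b ∧ G.Adj a c ∧ G.Adj a d ∧ G.Adj b c ∧ G.Adj b d ∧
      G.Adj c d ∧ s = {a, b, c, d} := by
  refine ⟨fun h => ?_, ?_⟩
  · obtain ⟨a, b, c, d, hab, hac, had, hbc, hbd, hcd, rfl⟩ := card_eq_four.1 h.2
    exact ⟨a, b, c, d, h.1 (by simp) (by simp) hab, h.1 (by simp) (by simp) hac,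
      h.1 (by simp) (by simp) had, h.1 (by simp) (by simp) hbc, h.1 (by simp) (by simp) hbd,
      h.1 (by simp) (by simp) hcd, rfl⟩
  · rintro ⟨a, b, c, d, hab, hac, had, hbc, hbd, hcd, rfl⟩
    refine (is3Clique_triple_iff.2 ⟨hbc, hbd, hcd⟩).insert ?_
    simp [hab, hac, had]

theorem stronglyCP_repGraph (k : Fin 6) : StronglyCP (repGraph k) 4 4 := by
  let part (p : Fin 4) : Finset (Fin 16) := {u | u.val / 4 = p.val}
  have mem_part {p u} : u ∈ part p ↔ u.val / 4 = p.val := by simp [part]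
  have card_part : ∀ p, #(part p) = 4 := by decide
  have part_inj : Function.Injective part := by decide +kernel
  refine stronglyCP_of_partition (P := univ.image part) ⟨?_, ?_, ?_, ?_⟩ ?_
  · rw [card_image_of_injective _ part_inj]; rfl
  · simp only [mem_image, mem_univ, true_and, forall_exists_index, forall_apply_eq_imp_iff]
    refine fun p => ⟨fun u hu v hv huv => repGraph_part k u v ?_ huv, card_part p⟩
    rw [mem_part.1 hu, mem_part.1 hv]
  · simp only [mem_image, mem_univ, true_and, forall_exists_index, forall_apply_eq_imp_iff]
    refine fun p q hpq => disjoint_left.2 fun u hp hq => hpq ?_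
    rw [Fin.ext ((mem_part.1 hp).symm.trans (mem_part.1 hq))]
  · decide +kernel
  · intro s hs
    obtain ⟨x, y, z, w, hxy, hxz, hxw, hyz, hyw, hzw, rfl⟩ := is4Clique_iff.1 hs
    have h {a b c d} (hab : (repGraph k).Adj a b) hac hbc had hbd hcd :=
      repGraph_clique k a b hab c hac hbc d had hbd hcd
    have h1 := h hxy hxz hyz hxw hyw hzw
    have h2 := h hxz hxy hyz.symm hxw hzw hyw
    have h3 := h hxw hxy hyw.symm hxz hzw.symm hyz
    refine mem_image.2 ⟨⟨x.val / 4, by omega⟩, mem_univ _, (eq_of_subset_of_card_le ?_ ?_).symm⟩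
    · intro u hu
      simp only [mem_insert, mem_singleton] at hu
      rw [mem_part]
      rcases hu with rfl | rfl | rfl | rfl
      exacts [rfl, h1.symm, h2.symm, h3.symm]
    · rw [card_part, hs.2]

/-- The sum of the cubes of the numbers of common neighbours over all pairs of vertices. -/
def codegreeCubeSum {V : Type} [Fintype V] (G : SimpleGraph V) [DecidableRel G.Adj] : ℕ :=
  ∑ u, ∑ v, (∑ w, if G.Adj u w ∧ G.Adj v w then 1 else 0) ^ 3

theorem codegreeCubeSum_eq_of_iso {V W : Type} [Fintype V] [Fintype W] {G : SimpleGraph V}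
    {H : SimpleGraph W} [DecidableRel G.Adj] [DecidableRel H.Adj] (f : G ≃g H) :
    codegreeCubeSum G = codegreeCubeSum H := by
  refine Fintype.sum_equiv f.toEquiv _ _ fun u => Fintype.sum_equiv f.toEquiv _ _ fun v => ?_
  congr 1
  refine Fintype.sum_equiv f.toEquiv _ _ fun w => ?_
  simp [f.map_adj_iff]

theorem codegreeCubeSum_repGraph (k : Fin 6) :
    codegreeCubeSum (repGraph k) = ![49080, 49056, 47472, 50592, 53232, 48192] k := by
  revert k; decide +kernel

theorem isEmpty_repGraph_iso {i j : Fin 6} (hij : i ≠ j) :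
    IsEmpty (repGraph i ≃g repGraph j) := by
  refine ⟨fun f => hij ?_⟩
  have h := codegreeCubeSum_eq_of_iso f
  rw [codegreeCubeSum_repGraph, codegreeCubeSum_repGraph] at h
  clear f hij
  revert i j; decide

/-- A labelled form of a maximal strongly `(4,4)`-clique-partitioned graph: the vertices `(p, i)`
with fixed `p` form a part. -/
structure IsPartitioned (H : SimpleGraph (Fin 4 × Fin 4)) : Prop where
  part : ∀ p i j, i ≠ j → H.Adj (p, i) (p, j)
  two_neighbors : ∀ x p, x.1 ≠ p → ∃ a b, a ≠ b ∧ ∀ k, H.Adj x (p, k) ↔ k = a ∨ k = b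
  clique : ∀ x y z w, H.Adj x y → H.Adj x z → H.Adj x w → H.Adj y z → H.Adj y w → H.Adj z w →
    x.1 = y.1

/-- The block of `H` between parts `p` and `q` is packed into `m`. -/
def IsBlock (H : SimpleGraph (Fin 4 × Fin 4)) (p q : Fin 4) (m : ℕ) : Prop :=
  ∀ i j : Fin 4, H.Adj (p, i) (q, j) ↔ bit m i j = true

namespace IsPartitioned

variable {H : SimpleGraph (Fin 4 × Fin 4)}

theorem exists_not_iff (hH : IsPartitioned H) {x y : Fin 4 × Fin 4} (hxy : H.Adj x y) {p : Fin 4}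
    (hx : x.1 ≠ p) : ∃ i, ¬(H.Adj x (p, i) ↔ H.Adj y (p, i)) := by
  by_contra! h
  obtain ⟨a, b, hab, hx'⟩ := hH.two_neighbors x p hx
  have ha : H.Adj x (p, a) := (hx' a).2 (.inl rfl)
  have hb : H.Adj x (p, b) := (hx' b).2 (.inr rfl)
  exact hx (hH.clique x (p, a) y (p, b) ha hxy hb ((h a).1 ha).symm (hH.part p a b hab)
    ((h b).1 hb))

theorem exists_pairMask (hH : IsPartitioned H) (x : Fin 4 × Fin 4) {p : Fin 4} (hx : x.1 ≠ p) :
    ∃ r ∈ pairMasks, ∀ k : Fin 4, H.Adj x (p, k) ↔ r.testBit k = true := by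
  obtain ⟨a, b, hab, h⟩ := hH.two_neighbors x p hx
  obtain ⟨r, hr, hr'⟩ := _root_.exists_pairMask a b hab
  exact ⟨r, hr, fun k => (h k).trans (hr' k).symm⟩

theorem exists_octagon (hH : IsPartitioned H) {p q : Fin 4} (hpq : p ≠ q) :
    ∃ m ∈ octagons, IsBlock H p q m := by
  choose r hr hr' using fun i => hH.exists_pairMask (p, i) hpq
  choose s hs hs' using fun j => hH.exists_pairMask (q, j) hpq.symm
  have hne {i i'} (hii : i ≠ i') : r i ≠ r i' := by
    intro h
    obtain ⟨k, hk⟩ := hH.exists_not_iff (hH.part p i i' hii) hpq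
    exact hk (by rw [hr', hr', h])
  have hrs (i j : Fin 4) : (r i).testBit j = (s j).testBit i := by
    rw [Bool.eq_iff_iff, ← hr', ← hs', H.adj_comm]
  obtain ⟨m, hm, h⟩ := octagon_of_rows (r 0) (hr 0) (r 1) (hr 1) (r 2) (hr 2) (r 3) (hr 3)
    (hne (by decide)) (hne (by decide)) (hne (by decide)) (hne (by decide)) (hne (by decide))
    (hne (by decide)) fun j => ⟨s j, hs j, hrs 0 j, hrs 1 j, hrs 2 j, hrs 3 j⟩
  refine ⟨m, hm, fun i j => ?_⟩
  have hrow : bit m i j = (r i).testBit j := by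
    fin_cases i
    exacts [(h j).1, (h j).2.1, (h j).2.2.1, (h j).2.2.2]
  rw [hr', hrow]

theorem twinFree (hH : IsPartitioned H) {p q r : Fin 4} {ab ac bc : ℕ} (hpq : p ≠ q) (hpr : p ≠ r)
    (hab : IsBlock H p q ab) (hac : IsBlock H p r ac) (hbc : IsBlock H q r bc) :
    twinFree ab ac bc = true := by
  have key {x y t} (hxy : H.Adj x y) (hx : x.1 ≠ t) {f g : ℕ → Bool}
      (hf : ∀ k : Fin 4, H.Adj x (t, k) ↔ f k = true)
      (hg : ∀ k : Fin 4, H.Adj y (t, k) ↔ g k = true) :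
      ∃ k < 4, f k ≠ g k := by
    obtain ⟨k, hk⟩ := hH.exists_not_iff hxy hx
    exact ⟨k, k.2, fun h => hk (by rw [hf, hg, h])⟩
  simp only [_root_.twinFree, List.all_eq_true, List.mem_range, Bool.and_eq_true, Bool.or_eq_true,
    List.any_eq_true, bne_iff_ne, Bool.not_eq_true', ← Bool.not_eq_true, ← imp_iff_not_or]
  intro i hi j hj
  lift i to Fin 4 using hi
  lift j to Fin 4 using hj
  refine ⟨⟨fun h => ?_, fun h => ?_⟩, fun h => ?_⟩
  · exact key ((hbc i j).2 h) hpq.symm (fun k => (H.adj_comm _ _).trans (hab k i))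
      (fun k => (H.adj_comm _ _).trans (hac k j))
  · exact key ((hac i j).2 h) hpq (fun k => hab i k)
      (fun k => (H.adj_comm _ _).trans (hbc k j))
  · exact key ((hab i j).2 h) hpr (fun k => hac i k) (fun k => hbc j k)

theorem rainbowFree (hH : IsPartitioned H) {c : Blocks} (h01 : IsBlock H 0 1 c.m01)
    (h02 : IsBlock H 0 2 c.m02) (h03 : IsBlock H 0 3 c.m03) (h12 : IsBlock H 1 2 c.m12)
    (h13 : IsBlock H 1 3 c.m13) (h23 : IsBlock H 2 3 c.m23) : rainbowFree c = true := by
  simp only [_root_.rainbowFree, List.all_eq_true, List.mem_range, Bool.and_eq_true,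
    Bool.or_eq_true, Bool.not_eq_true', ← Bool.not_eq_true, ← imp_iff_not_or]
  rintro i hi j hj hij k hk ⟨hik, hjk⟩ l hl ⟨⟨hil, hjl⟩, hkl⟩
  lift i to Fin 4 using hi
  lift j to Fin 4 using hj
  lift k to Fin 4 using hk
  lift l to Fin 4 using hl
  exact Fin.zero_ne_one (hH.clique (0, i) (1, j) (2, k) (3, l) ((h01 i j).2 hij) ((h02 i k).2 hik)
    ((h03 i l).2 hil) ((h12 j k).2 hjk) ((h13 j l).2 hjl) ((h23 k l).2 hkl))

/-- Permuting the vertices inside each part. -/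
theorem comap (hH : IsPartitioned H) (σ : Fin 4 → Equiv.Perm (Fin 4)) :
    IsPartitioned (H.comap (Equiv.prodShear (Equiv.refl _) σ)) where
  part p i j hij := hH.part p _ _ ((σ p).injective.ne hij)
  two_neighbors x p hx := by
    obtain ⟨a, b, hab, h⟩ := hH.two_neighbors (Equiv.prodShear (Equiv.refl _) σ x) p hx
    refine ⟨(σ p).symm a, (σ p).symm b, (σ p).symm.injective.ne hab, fun k => ?_⟩
    rw [Equiv.eq_symm_apply, Equiv.eq_symm_apply]
    exact h (σ p k)
  clique _ _ _ _ hxy hxz hxw hyz hyw hzw :=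
    hH.clique (Equiv.prodShear (Equiv.refl _) σ _) (Equiv.prodShear (Equiv.refl _) σ _) _ _
      hxy hxz hxw hyz hyw hzw

end IsPartitioned

/-- Blocks of `H` suffice to recognise that `H` is isomorphic to a representative. -/
theorem nonempty_iso_of_carries {H : SimpleGraph (Fin 4 × Fin 4)} (hH : IsPartitioned H)
    {c : Blocks} (h01 : IsBlock H 0 1 c.m01) (h02 : IsBlock H 0 2 c.m02)
    (h03 : IsBlock H 0 3 c.m03) (h12 : IsBlock H 1 2 c.m12) (h13 : IsBlock H 1 3 c.m13)
    (h23 : IsBlock H 2 3 c.m23) {w : ℕ} {k : Fin 6} (hw : carries w c (repCode k) = true) :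
    Nonempty (H ≃g repGraph k) := by
  simp only [carries, Bool.and_eq_true, List.all_eq_true, List.mem_range, decide_eq_true_eq,
    beq_iff_eq, Bool.or_eq_true] at hw
  obtain ⟨⟨⟨⟨⟨⟨⟨w01, w02⟩, w03⟩, w12⟩, w13⟩, w23⟩, hpart⟩, hnodup⟩ := hw
  let f (x : Fin 4 × Fin 4) : Fin 16 := ⟨digit w (4 * x.1 + x.2), Nat.mod_lt _ (by norm_num)⟩
  have hf : Function.Injective f := by
    rintro ⟨p, i⟩ ⟨q, j⟩ h
    have := List.inj_on_of_nodup_map hnodup (List.mem_range.2 (by omega : 4 * p.val + i.val < 16))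
      (List.mem_range.2 (by omega : 4 * q.val + j.val < 16)) (congrArg Fin.val h)
    ext <;> simp <;> omega
  have hadj : ∀ p q i j, p ≤ q →
      ((repGraph k).Adj (f (p, i)) (f (q, j)) ↔ H.Adj (p, i) (q, j)) := by
    intro p q i j hpq
    have block {p q m} (hm : IsBlock H p q m) (hw : ∀ i < 4, ∀ j < 4,
        bit m i j = (repCode k).testBit (16 * digit w (4 * p.val + i) + digit w (4 * q.val + j))) :
        (repGraph k).Adj (f (p, i)) (f (q, j)) ↔ H.Adj (p, i) (q, j) := by
      rw [hm i j, hw i i.2 j j.2]; rfl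
    rcases eq_or_ne p q with rfl | hne
    · by_cases hij : i = j
      · simp [hij]
      · refine iff_of_true ?_ (hH.part p i j hij)
        exact (hpart p p.2 i i.2 j j.2).resolve_left (Fin.val_ne_of_ne hij)
    · fin_cases p <;> fin_cases q <;> first
        | exact absurd rfl hne
        | exact absurd hpq (by decide)
        | exact block h01 w01
        | exact block h02 w02
        | exact block h03 w03
        | exact block h12 w12
        | exact block h13 w13
        | exact block h23 w23
  refine ⟨⟨Equiv.ofBijective f ((Fintype.bijective_iff_injective_and_card f).2 ⟨hf, rfl⟩), ?_⟩⟩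
  rintro ⟨p, i⟩ ⟨q, j⟩
  rcases le_total p q with h | h
  · exact hadj p q i j h
  · rw [adj_comm, H.adj_comm]
    exact hadj q p j i h

theorem IsPartitioned.exists_iso_of_normal {H : SimpleGraph (Fin 4 × Fin 4)} (hH : IsPartitioned H)
    {t₂ t₃ : ℕ} (h01 : IsBlock H 0 1 stdOctagon) (ht₂ : t₂ ∈ halfStdOctagons)
    (h02 : IsBlock H 0 2 t₂) (ht₃ : t₃ ∈ halfStdOctagons) (h03 : IsBlock H 0 3 t₃) :
    ∃ k, Nonempty (H ≃g repGraph k) := by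
  obtain ⟨x, hx, h12⟩ := hH.exists_octagon (p := 1) (q := 2) (by decide)
  obtain ⟨y, hy, h13⟩ := hH.exists_octagon (p := 1) (q := 3) (by decide)
  obtain ⟨z, hz, h23⟩ := hH.exists_octagon (p := 2) (q := 3) (by decide)
  have h := allCarried_halfStdOctagons t₂ ht₂ t₃ ht₃
  simp only [allCarried, List.all_eq_true, List.mem_filter] at h
  have h := h x ⟨hx, hH.twinFree (by decide) (by decide) h01 h02 h12⟩
    y ⟨hy, hH.twinFree (by decide) (by decide) h01 h03 h13⟩
    z ⟨hz, hH.twinFree (by decide) (by decide) h02 h03 h23⟩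
  rw [hH.twinFree (by decide) (by decide) h12 h13 h23,
    hH.rainbowFree h01 h02 h03 h12 h13 h23] at h
  simp only [Bool.not_true, Bool.false_or, List.any_eq_true, Bool.and_eq_true] at h
  obtain ⟨e, -, -, k, -, -, hk⟩ := h
  exact ⟨k, nonempty_iso_of_carries hH h01 h02 h03 h12 h13 h23 hk⟩

theorem IsPartitioned.exists_iso {H : SimpleGraph (Fin 4 × Fin 4)} (hH : IsPartitioned H) :
    ∃ k, Nonempty (H ≃g repGraph k) := by
  obtain ⟨m, hm, hm'⟩ := hH.exists_octagon (p := 0) (q := 1) (by decide)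
  obtain ⟨t, ht, τ, hτ⟩ := exists_perm_halfStd m hm
  obtain ⟨σ, τ', hστ⟩ := exists_perm_std t ht
  have rename (q : Fin 4) (hq : 0 ≠ q) : ∃ t ∈ halfStdOctagons, ∃ ρ : Equiv.Perm (Fin 4),
      ∀ i j : Fin 4, H.Adj (0, σ i) (q, ρ j) ↔ bit t i j = true := by
    obtain ⟨m, hm, hm'⟩ :=
      (hH.comap fun p => if p = 0 then σ else Equiv.refl _).exists_octagon hq
    obtain ⟨t, ht, ρ, hρ⟩ := exists_perm_halfStd m hm
    refine ⟨t, ht, ρ, fun i j => ?_⟩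
    rw [← hρ, ← hm']
    simp [Equiv.prodShear, hq.symm]
  obtain ⟨t₂, ht₂, ρ₂, h₂⟩ := rename 2 (by decide)
  obtain ⟨t₃, ht₃, ρ₃, h₃⟩ := rename 3 (by decide)
  obtain ⟨k, ⟨f⟩⟩ := (hH.comap ![σ, τ'.trans τ, ρ₂, ρ₃]).exists_iso_of_normal
    (fun i j => (hm' (σ i) (τ (τ' j))).trans (by rw [hτ, hστ])) ht₂ h₂ ht₃ h₃
  exact ⟨k, ⟨(Iso.comap _ H).symm.trans f⟩⟩

section Labelling

variable {V : Type} [Fintype V] [DecidableEq V] {G : SimpleGraph V} {P : Finset (Finset V)}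

/-- In a strongly clique-partitioned graph, a vertex outside a part has at most two neighbours
in it. -/
theorem card_neighbors_le_two [DecidableRel G.Adj] (hP : IsCliquePartition G 4 4 P)
    (hG : ∀ s, G.IsNClique 4 s → s ∈ P) {s : Finset V} (hs : s ∈ P) {v : V} (hv : v ∉ s) :
    #{u ∈ s | G.Adj v u} ≤ 2 := by
  by_contra! h
  obtain ⟨t, ht, ht3⟩ := exists_subset_card_eq (Nat.succ_le_of_lt h)
  have hts : t ⊆ s := ht.trans (filter_subset _ _)
  have hclique : G.IsNClique 3 t := ⟨(hP.2.1 s hs).1.subset (by exact_mod_cast hts), ht3⟩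
  have hmem := hG _ (hclique.insert fun b hb => (mem_filter.1 (ht hb)).2)
  have hne : insert v t ≠ s := fun h => hv (h ▸ mem_insert_self v t)
  obtain ⟨b, hb⟩ : t.Nonempty := card_pos.1 (by omega)
  exact disjoint_left.1 (hP.2.2.1 _ hmem s hs hne) (mem_insert_of_mem hb) (hts hb)

theorem card_neighbors_eq_two [DecidableRel G.Adj] (hP : IsCliquePartition G 4 4 P)
    (hG : ∀ s, G.IsNClique 4 s → s ∈ P) (hcard : Fintype.card V = 16)
    (hedges : Nat.card G.edgeSet = 72) {s : Finset V} (hs : s ∈ P) {v : V} (hv : v ∉ s) :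
    #{u ∈ s | G.Adj v u} = 2 := by
  have hdeg (v : V) : G.degree v = ∑ s ∈ P, #{u ∈ s | G.Adj v u} := by
    rw [← card_neighborFinset_eq_degree, neighborFinset_eq_filter, ← hP.2.2.2, filter_biUnion,
      card_biUnion]
    · rfl
    · exact fun s hs t ht hst =>
        (hP.2.2.1 s hs t ht hst).mono (filter_subset _ _) (filter_subset _ _)
  have hbound (v : V) : ∃ t ∈ P, v ∈ t ∧ G.degree v ≤ 3 + ∑ s ∈ P.erase t, #{u ∈ s | G.Adj v u} ∧
      ∀ s ∈ P.erase t, #{u ∈ s | G.Adj v u} ≤ 2 := by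
    obtain ⟨t, ht, hvt : v ∈ t⟩ := mem_biUnion.1 (hP.2.2.2 ▸ mem_univ v)
    refine ⟨t, ht, hvt, ?_, fun s hs => ?_⟩
    · rw [hdeg, ← add_sum_erase _ _ ht]
      gcongr
      calc #{u ∈ t | G.Adj v u} ≤ #(t.erase v) :=
            card_le_card fun u hu => by
              rw [mem_filter] at hu
              exact mem_erase.2 ⟨hu.2.ne', hu.1⟩
        _ = 3 := by rw [card_erase_of_mem hvt, (hP.2.1 t ht).2]
    · obtain ⟨hst, hs⟩ := mem_erase.1 hs
      exact card_neighbors_le_two hP hG hs fun hvs =>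
        disjoint_left.1 (hP.2.2.1 s hs t ht hst) hvs hvt
  have hle (v : V) : G.degree v ≤ 9 := by
    obtain ⟨t, ht, -, h, h2⟩ := hbound v
    have := sum_le_card_nsmul _ _ 2 h2
    rw [card_erase_of_mem ht, hP.1, smul_eq_mul] at this
    omega
  have hsum : ∑ v, G.degree v = ∑ _v : V, 9 := by
    rw [G.sum_degrees_eq_twice_card_edges, edgeFinset_card, ← Nat.card_eq_fintype_card, hedges,
      sum_const, card_univ, hcard]
    rfl
  have heq := (sum_eq_sum_iff_of_le fun v _ => hle v).1 hsum v (mem_univ v)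
  obtain ⟨t, ht, hvt, h, h2⟩ := hbound v
  refine (card_neighbors_le_two hP hG hs hv).antisymm ?_
  have hst : s ∈ P.erase t := mem_erase.2 ⟨fun h => hv (h ▸ hvt), hs⟩
  have h2' := sum_le_card_nsmul _ _ 2 fun s' (hs' : s' ∈ (P.erase t).erase s) =>
    h2 s' (mem_of_mem_erase hs')
  rw [← add_sum_erase _ _ hst] at h
  rw [card_erase_of_mem hst, card_erase_of_mem ht, hP.1, smul_eq_mul] at h2'
  omega

theorem exists_labelling (hP : IsCliquePartition G 4 4 P) (hcard : Fintype.card V = 16) :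
    ∃ e : Fin 4 × Fin 4 ≃ V, ∀ p, univ.image (fun i => e (p, i)) ∈ P := by
  let g : Fin 4 ≃ P := (P.equivFinOfCardEq hP.1).symm
  let h (p : Fin 4) : Fin 4 ≃ (g p).1 :=
    ((g p).1.equivFinOfCardEq (hP.2.1 _ (g p).2).2).symm
  let f (x : Fin 4 × Fin 4) : V := (h x.1 x.2).1
  have hf : Function.Injective f := by
    rintro ⟨p, i⟩ ⟨q, j⟩ hpq
    have hp : f (p, i) ∈ (g p).1 := (h p i).2
    have hq : f (p, i) ∈ (g q).1 := hpq ▸ (h q j).2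
    obtain rfl : p = q := by
      by_contra hne
      exact disjoint_left.1 (hP.2.2.1 _ (g p).2 _ (g q).2 fun h =>
        hne (g.injective (Subtype.ext h))) hp hq
    exact congrArg _ ((h p).injective (Subtype.ext hpq))
  refine ⟨Equiv.ofBijective f ((Fintype.bijective_iff_injective_and_card f).2 ⟨hf, ?_⟩),
    fun p => ?_⟩
  · rw [hcard]; rfl
  · convert (g p).2
    ext v
    simp only [mem_image, mem_univ, true_and, Equiv.ofBijective_apply]
    exact ⟨fun ⟨i, hi⟩ => hi ▸ (h p i).2, fun hv => ⟨(h p).symm ⟨v, hv⟩, by simp [f]⟩⟩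

theorem exists_isPartitioned (hG : StronglyCP G 4 4) (hedges : Nat.card G.edgeSet = 72) :
    ∃ H : SimpleGraph (Fin 4 × Fin 4), IsPartitioned H ∧ Nonempty (G ≃g H) := by
  classical
  obtain ⟨⟨hcard, P, hP, -⟩, hclique⟩ := hG
  obtain ⟨e, he⟩ := exists_labelling hP hcard
  let part (p : Fin 4) : Finset V := univ.image fun i => e (p, i)
  have mem_part {p x} : e x ∈ part p ↔ x.1 = p := by
    simp only [part, mem_image, mem_univ, true_and, e.injective.eq_iff]
    exact ⟨fun ⟨i, hi⟩ => hi ▸ rfl, fun h => ⟨x.2, h ▸ rfl⟩⟩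
  refine ⟨G.comap e, ⟨fun p i j hij => ?_, fun x p hx => ?_, ?_⟩, ⟨(Iso.comap e G).symm⟩⟩
  · exact (hP.2.1 _ (he p)).1 (by simp) (by simp)
      (e.injective.ne (by simpa using hij))
  · have h := card_neighbors_eq_two hP (hclique P hP) hcard hedges (he p) (v := e x)
      (mem_part.not.2 hx)
    rw [filter_image, card_image_of_injective _ fun i j hij => by simpa using hij] at h
    obtain ⟨a, b, hab, h⟩ := card_eq_two.1 h
    exact ⟨a, b, hab, fun k => by simpa using Finset.ext_iff.1 h k⟩
  · intro x y z w hxy hxz hxw hyz hyw hzw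
    have hs := hclique P hP {e x, e y, e z, e w}
      (is4Clique_iff.2 ⟨_, _, _, _, hxy, hxz, hxw, hyz, hyw, hzw, rfl⟩)
    by_contra hne
    have hdisj := hP.2.2.1 _ hs (part x.1) (he x.1) fun h =>
      hne (mem_part.1 (h ▸ by simp : e y ∈ part x.1)).symm
    exact disjoint_left.1 hdisj (by simp) (mem_part.2 rfl)

end Labelling

/-- Up to isomorphism there are precisely six strongly
`(4,4)`-clique-partitioned graphs with the maximum number `72` of edges. -/
theorem strongly_cp_44_six_classes :
    ∃ Gs : Fin 6 → SimpleGraph (Fin 16),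
      (∀ i : Fin 6, StronglyCP (Gs i) 4 4 ∧ Nat.card (Gs i).edgeSet = 72) ∧
      (∀ i j : Fin 6, i ≠ j → IsEmpty (Gs i ≃g Gs j)) ∧
      ∀ {V : Type} [Fintype V] [DecidableEq V] (G : SimpleGraph V),
        StronglyCP G 4 4 → Nat.card G.edgeSet = 72 →
        ∃ i : Fin 6, Nonempty (G ≃g Gs i) := by
  refine ⟨repGraph, fun k => ⟨stronglyCP_repGraph k, card_edgeSet_repGraph k⟩,
    fun i j hij => isEmpty_repGraph_iso hij, fun G hG hedges => ?_⟩
  obtain ⟨H, hH, ⟨f⟩⟩ := exists_isPartitioned hG hedges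
  obtain ⟨k, ⟨g⟩⟩ := hH.exists_iso
  exact ⟨k, ⟨f.trans g⟩⟩
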